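/- Let q = (q_n)_{n≥1} be a P-admissible sequence. Then for every k ≥ 1, the finite tuple (q_1,…,q_k) is P-admissible and Inf^{P⁻}(q_1…q_k) < val_{P⁻}(q) < Sup^{P⁻}(q_1…q_k). -/

import Mathlib

open Filter Finset Topology

/-! `φ` encodes the family of functions: `φ []` is `φ₀` and
`φ [c₁, …, cₙ]` is `φₙ(c₁, …, cₙ)`. Sequences are 0-indexed:
`p 0` is the paper's `p₁`. -/

/-- The list of the first `n` terms of the sequence `p`. -/
def prefixList (p : ℕ → ℕ) (n : ℕ) : List ℕ :=
  List.ofFn (fun i : Fin n => p i)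

/-- A sequence `p` is `P`-admissible if `pₙ ≥ r_{n-1} + 1` for all `n ≥ 1`. -/
def PAdmissibleSeq (φ : List ℕ → ℕ) (p : ℕ → ℕ) : Prop :=
  ∀ n : ℕ, φ (prefixList p n) + 1 ≤ p n

/-- A tuple `(c₁, …, c_k)` (given as the first `k` values of `c`) is `P`-admissible. -/
def PAdmissibleTuple (φ : List ℕ → ℕ) (c : ℕ → ℕ) (k : ℕ) : Prop :=
  ∀ n < k, φ (prefixList c n) + 1 ≤ c n

/-- `r₀ r₁ ⋯ rₙ` where `rᵢ = φᵢ(p₁, …, pᵢ)`. -/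
noncomputable def numer (φ : List ℕ → ℕ) (p : ℕ → ℕ) (n : ℕ) : ℝ :=
  ∏ i ∈ Finset.range (n + 1), (φ (prefixList p i) : ℝ)

/-- `(p₁ − 1)p₁ ⋯ (pₙ − 1)pₙ`. -/
noncomputable def denomBase (p : ℕ → ℕ) (n : ℕ) : ℝ :=
  ∏ j ∈ Finset.range n, (((p j : ℝ) - 1) * (p j : ℝ))

/-- The `P`-value `val_P(p) = Σ_{n=0}^∞ (r₀⋯rₙ)/((p₁−1)p₁⋯(pₙ−1)pₙ·p_{n+1})`. -/
noncomputable def valP (φ : List ℕ → ℕ) (p : ℕ → ℕ) : ℝ :=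
  ∑' n : ℕ, numer φ p n / (denomBase p n * (p n : ℝ))

/-- The `P⁻`-value
`val_{P⁻}(q) = Σ_{n=0}^∞ (−1)ⁿ (r₀⋯rₙ)/((q₁−1)q₁⋯(qₙ−1)qₙ·(q_{n+1}−1))`. -/
noncomputable def valPNeg (φ : List ℕ → ℕ) (q : ℕ → ℕ) : ℝ :=
  ∑' n : ℕ, (-1 : ℝ) ^ n * numer φ q n / (denomBase q n * ((q n : ℝ) - 1))

/-- `Inf^P(c₁…c_k) = Σ_{n=0}^{k−1} (r₀⋯rₙ)/((c₁−1)c₁⋯(cₙ−1)cₙ·c_{n+1})`. -/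
noncomputable def InfP (φ : List ℕ → ℕ) (c : ℕ → ℕ) (k : ℕ) : ℝ :=
  ∑ n ∈ Finset.range k, numer φ c n / (denomBase c n * (c n : ℝ))

/-- The diameter `(r₀⋯r_{k−1})/((c₁−1)c₁⋯(c_k−1)c_k)`. -/
noncomputable def DiamP (φ : List ℕ → ℕ) (c : ℕ → ℕ) (k : ℕ) : ℝ :=
  (∏ i ∈ Finset.range k, (φ (prefixList c i) : ℝ)) / denomBase c k

/-- `Sup^P(c₁…c_k) = Inf^P(c₁…c_k) + (r₀⋯r_{k−1})/((c₁−1)c₁⋯(c_k−1)c_k)`. -/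
noncomputable def SupP (φ : List ℕ → ℕ) (c : ℕ → ℕ) (k : ℕ) : ℝ :=
  InfP φ c k + DiamP φ c k

/-- `A(c₁…c_k) = Σ_{n=0}^{k−1} (−1)ⁿ (r₀⋯rₙ)/((c₁−1)c₁⋯(cₙ−1)cₙ·(c_{n+1}−1))`. -/
noncomputable def APNeg (φ : List ℕ → ℕ) (c : ℕ → ℕ) (k : ℕ) : ℝ :=
  ∑ n ∈ Finset.range k, (-1 : ℝ) ^ n * numer φ c n / (denomBase c n * ((c n : ℝ) - 1))

/-- `Sup^{P⁻}(c₁…c_k)`: `A` if `k` odd, `A + D` if `k` even. -/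
noncomputable def SupPNeg (φ : List ℕ → ℕ) (c : ℕ → ℕ) (k : ℕ) : ℝ :=
  if Odd k then APNeg φ c k else APNeg φ c k + DiamP φ c k

/-- `Inf^{P⁻}(c₁…c_k)`: `A − D` if `k` odd, `A` if `k` even. -/
noncomputable def InfPNeg (φ : List ℕ → ℕ) (c : ℕ → ℕ) (k : ℕ) : ℝ :=
  if Odd k then APNeg φ c k - DiamP φ c k else APNeg φ c k

lemma summable_alternating_of_le_half {a : ℕ → ℝ} (ha : ∀ n, 0 < a n)
    (h : ∀ n, a (n + 1) ≤ a n / 2) : Summable fun n => (-1 : ℝ) ^ n * a n := by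
  refine summable_of_ratio_norm_eventually_le (r := 1 / 2) (by norm_num)
    (Eventually.of_forall fun n => ?_)
  simp only [norm_mul, norm_pow, norm_neg, norm_one, one_pow, one_mul, Real.norm_eq_abs,
    abs_of_pos (ha _)]
  linarith [h n]

lemma tsum_alternating_eq_sub {a : ℕ → ℝ} (ha : ∀ n, 0 < a n)
    (h : ∀ n, a (n + 1) ≤ a n / 2) :
    ∑' n, (-1 : ℝ) ^ n * a n = a 0 - ∑' n, (-1 : ℝ) ^ n * a (n + 1) := by
  rw [(summable_alternating_of_le_half ha h).tsum_eq_zero_add]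
  simp [pow_succ, tsum_neg, sub_eq_add_neg]

lemma tsum_alternating_nonneg {a : ℕ → ℝ} (ha : ∀ n, 0 < a n)
    (h : ∀ n, a (n + 1) ≤ a n / 2) : 0 ≤ ∑' n, (-1 : ℝ) ^ n * a n := by
  have hanti : Antitone a := antitone_nat_of_succ_le fun n => by linarith [h n, ha n]
  simpa using hanti.alternating_series_le_tendsto
    (summable_alternating_of_le_half ha h).hasSum.tendsto_sum_nat 0

lemma tsum_alternating_mem_Ioo {a : ℕ → ℝ} (ha : ∀ n, 0 < a n)
    (h : ∀ n, a (n + 1) ≤ a n / 2) :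
    ∑' n, (-1 : ℝ) ^ n * a n ∈ Set.Ioo 0 (a 0) := by
  have e₀ := tsum_alternating_eq_sub ha h
  have e₁ := tsum_alternating_eq_sub (fun n => ha (n + 1)) (fun n => h (n + 1))
  have e₂ := tsum_alternating_eq_sub (fun n => ha (n + 1 + 1)) (fun n => h (n + 1 + 1))
  have n₂ := tsum_alternating_nonneg (fun n => ha (n + 1 + 1)) (fun n => h (n + 1 + 1))
  have n₃ := tsum_alternating_nonneg (fun n => ha (n + 1 + 1 + 1)) (fun n => h (n + 1 + 1 + 1))
  have h₀ := h 0
  have h₁ := h 1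
  have p₀ := ha 0
  have p₁ := ha 1
  simp only [zero_add, Nat.reduceAdd] at *
  constructor <;> linarith

/-- The absolute value of the `n`-th term of the series defining `valPNeg`. -/
noncomputable def absTerm (φ : List ℕ → ℕ) (q : ℕ → ℕ) (n : ℕ) : ℝ :=
  numer φ q n / (denomBase q n * ((q n : ℝ) - 1))

section Admissible

variable {φ : List ℕ → ℕ} {q : ℕ → ℕ}

lemma PAdmissibleSeq.le_sub_one (hq : PAdmissibleSeq φ q) (n : ℕ) :
    (φ (prefixList q n) : ℝ) ≤ q n - 1 := by
  have : (φ (prefixList q n) : ℝ) + 1 ≤ q n := by exact_mod_cast hq n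
  linarith

lemma PAdmissibleSeq.one_lt (hφ : ∀ l, 0 < φ l) (hq : PAdmissibleSeq φ q) (n : ℕ) :
    1 < q n := by
  have := hq n
  have := hφ (prefixList q n)
  omega

lemma PAdmissibleSeq.diamP_pos (hφ : ∀ l, 0 < φ l) (hq : PAdmissibleSeq φ q) (n : ℕ) :
    0 < DiamP φ q n := by
  refine div_pos (prod_pos fun i _ => by exact_mod_cast hφ _) (prod_pos fun i _ => ?_)
  have : (1 : ℝ) < q i := by exact_mod_cast hq.one_lt hφ i
  exact mul_pos (by linarith) (by linarith)

lemma absTerm_eq_diamP_mul (n : ℕ) :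
    absTerm φ q n = DiamP φ q n * (φ (prefixList q n) / ((q n : ℝ) - 1)) := by
  rw [absTerm, numer, DiamP, prod_range_succ, mul_div_mul_comm]

lemma diamP_succ (n : ℕ) : DiamP φ q (n + 1) = absTerm φ q n / q n := by
  rw [absTerm, numer, DiamP, div_div, mul_assoc]
  simp only [denomBase, prod_range_succ]

lemma PAdmissibleSeq.absTerm_pos (hφ : ∀ l, 0 < φ l) (hq : PAdmissibleSeq φ q) (n : ℕ) :
    0 < absTerm φ q n := by
  have h₁ : (1 : ℝ) < q n := by exact_mod_cast hq.one_lt hφ n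
  have h₂ : (0 : ℝ) < φ (prefixList q n) := by exact_mod_cast hφ _
  rw [absTerm_eq_diamP_mul]
  exact mul_pos (hq.diamP_pos hφ n) (div_pos h₂ (by linarith))

lemma PAdmissibleSeq.absTerm_le_diamP (hφ : ∀ l, 0 < φ l) (hq : PAdmissibleSeq φ q) (n : ℕ) :
    absTerm φ q n ≤ DiamP φ q n := by
  have h₁ : (1 : ℝ) < q n := by exact_mod_cast hq.one_lt hφ n
  rw [absTerm_eq_diamP_mul]
  exact mul_le_of_le_one_right (hq.diamP_pos hφ n).le
    ((div_le_one (by linarith)).2 (hq.le_sub_one n))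

lemma PAdmissibleSeq.absTerm_succ_le (hφ : ∀ l, 0 < φ l) (hq : PAdmissibleSeq φ q) (n : ℕ) :
    absTerm φ q (n + 1) ≤ absTerm φ q n / 2 := by
  refine (hq.absTerm_le_diamP hφ (n + 1)).trans ?_
  rw [diamP_succ]
  have h₂ : (2 : ℝ) ≤ q n := by exact_mod_cast hq.one_lt hφ n
  exact div_le_div_of_nonneg_left (hq.absTerm_pos hφ n).le two_pos h₂

lemma PAdmissibleSeq.valPNeg_eq (hφ : ∀ l, 0 < φ l) (hq : PAdmissibleSeq φ q) (k : ℕ) :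
    valPNeg φ q =
      APNeg φ q k + (-1 : ℝ) ^ k * ∑' n, (-1 : ℝ) ^ n * absTerm φ q (n + k) := by
  have hs := summable_alternating_of_le_half (hq.absTerm_pos hφ) (hq.absTerm_succ_le hφ)
  simp only [valPNeg, APNeg, mul_div_assoc]
  simp only [absTerm] at hs ⊢
  rw [← hs.sum_add_tsum_nat_add k, ← tsum_mul_left]
  congr 2
  ext n
  ring

end Admissible

/-- `Inf^{P⁻}(q₁…q_k) < val_{P⁻}(q) < Sup^{P⁻}(q₁…q_k)` for every `k ≥ 1`. -/
theorem stmt19 (φ : List ℕ → ℕ) (hφ : ∀ l, 0 < φ l)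
    (q : ℕ → ℕ) (hq : PAdmissibleSeq φ q) :
    ∀ k : ℕ, 0 < k → PAdmissibleTuple φ q k ∧
      InfPNeg φ q k < valPNeg φ q ∧ valPNeg φ q < SupPNeg φ q k := by
  intro k _
  refine ⟨fun n _ => hq n, ?_⟩
  obtain ⟨hpos, hlt⟩ := tsum_alternating_mem_Ioo (a := fun n => absTerm φ q (n + k))
    (fun n => hq.absTerm_pos hφ (n + k))
    (fun n => by simpa only [add_right_comm] using hq.absTerm_succ_le hφ (n + k))
  rw [zero_add] at hlt
  have hle := hq.absTerm_le_diamP hφ k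
  rw [hq.valPNeg_eq hφ k, InfPNeg, SupPNeg]
  split_ifs with hk
  · rw [hk.neg_one_pow]
    constructor <;> linarith
  · rw [(Nat.not_odd_iff_even.1 hk).neg_one_pow]
    constructor <;> linarith
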